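/- Let Σ be an alphabet and L ⊆ List Σ a language. Then L ∈ RevL(ZMod 2, Σ) if and only if L is recognized by a finite monoid whose idempotents commute: there exist a finite monoid M satisfying e * f = f * e for all idempotents e, f ∈ M (i.e., all e, f with e * e = e and f * f = f), a monoid homomorphism φ : FreeMonoid Σ →* M, and a subset T ⊆ M such that L = φ⁻¹(T). (Equivalently, the syntactic monoid of L belongs to the pseudovariety ECom of finite monoids with commuting idempotents.) -/

import Mathlib

open Matrix

namespace RevWA

/-- A weighted automaton over a semiring `S` and alphabet `α`, given by a linear
representation: number of states `n`, initial weight vector, transition matrices,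
and final weight vector. -/
structure WA (S : Type) [Semiring S] (α : Type) where
  n : ℕ
  init : Fin n → S
  trans : α → Matrix (Fin n) (Fin n) S
  final : Fin n → S

variable {S : Type} [Semiring S] {α : Type}

/-- The matrix associated to a word: product of the transition matrices of its letters. -/
def WA.matWord (A : WA S α) (w : List α) : Matrix (Fin A.n) (Fin A.n) S :=
  (w.map A.trans).prod

/-- The series realized by a weighted automaton: `i ⬝ μ(w) ⬝ f`. -/
def WA.series (A : WA S α) : List α → S :=
  fun w => A.init ⬝ᵥ (A.matWord w).mulVec A.final

/-- A matrix has at most one nonzero entry in each row. -/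
def rowOk {n : ℕ} (M : Matrix (Fin n) (Fin n) S) : Prop :=
  ∀ i j j', M i j ≠ 0 → M i j' ≠ 0 → j = j'

/-- A matrix has at most one nonzero entry in each column. -/
def colOk {n : ℕ} (M : Matrix (Fin n) (Fin n) S) : Prop :=
  ∀ i i' j, M i j ≠ 0 → M i' j ≠ 0 → i = i'

/-- A weighted automaton is reversible if each transition matrix has at most one
nonzero entry in each row and at most one nonzero entry in each column. -/
def WA.Reversible (A : WA S α) : Prop :=
  ∀ a : α, rowOk (A.trans a) ∧ colOk (A.trans a)

/-- A weighted automaton has exactly one initial state. -/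
def WA.OneInitial (A : WA S α) : Prop :=
  ∃! q : Fin A.n, A.init q ≠ 0

/-- `Rev S α`: series realized by reversible weighted automata over `S` and `α`. -/
def Rev (S : Type) [Semiring S] (α : Type) : Set (List α → S) :=
  {r | ∃ A : WA S α, A.Reversible ∧ A.series = r}

/-- `Rev₁ S α`: series realized by reversible weighted automata over `S` and `α`
with exactly one initial state. -/
def Rev1 (S : Type) [Semiring S] (α : Type) : Set (List α → S) :=
  {r | ∃ A : WA S α, A.Reversible ∧ A.OneInitial ∧ A.series = r}

/-- The support of a series. -/
def supp (r : List α → S) : Set (List α) :=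
  {w | r w ≠ 0}

/-- `RevL S α`: supports of series realized by reversible weighted automata. -/
def RevL (S : Type) [Semiring S] (α : Type) : Set (Set (List α)) :=
  {L | ∃ r ∈ Rev S α, supp r = L}

/-- `RevL₁ S α`: supports of series realized by reversible weighted automata with
exactly one initial state. -/
def RevL1 (S : Type) [Semiring S] (α : Type) : Set (Set (List α)) :=
  {L | ∃ r ∈ Rev1 S α, supp r = L}

/-- The characteristic series of a language `L` over `S`. -/
noncomputable def charSeries (S : Type) [Semiring S] {α : Type} (L : Set (List α)) :
    List α → S :=
  L.indicator 1

/-- A reversible nondeterministic finite automaton: deterministic and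
codeterministic transition relation. -/
structure RevNFA (α : Type) where
  Q : Type
  fintypeQ : Fintype Q
  δ : Q → α → Q → Prop
  I : Set Q
  F : Set Q
  det : ∀ p a q q', δ p a q → δ p a q' → q = q'
  codet : ∀ p p' a q, δ p a q → δ p' a q → p = p'

/-- Paths in a reversible NFA. -/
inductive RevNFA.Path {α : Type} (A : RevNFA α) : A.Q → List α → A.Q → Prop
  | nil (q : A.Q) : RevNFA.Path A q [] q
  | cons {p q r : A.Q} {a : α} {w : List α} :
      A.δ p a q → RevNFA.Path A q w r → RevNFA.Path A p (a :: w) r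

/-- The language recognized by a reversible NFA. -/
def RevNFA.lang {α : Type} (A : RevNFA α) : Set (List α) :=
  {w | ∃ p ∈ A.I, ∃ q ∈ A.F, A.Path p w q}

/-- A reversible NFA has exactly one initial state. -/
def RevNFA.OneInitial {α : Type} (A : RevNFA α) : Prop :=
  ∃ q : A.Q, A.I = {q}

/-- `RevL(𝔹,α)`: languages recognized by reversible NFAs. -/
def RevLB (α : Type) : Set (Set (List α)) :=
  {L | ∃ A : RevNFA α, A.lang = L}

/-- `RevL₁(𝔹,α)`: languages recognized by reversible NFAs with exactly one
initial state. -/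
def RevL1B (α : Type) : Set (Set (List α)) :=
  {L | ∃ A : RevNFA α, A.OneInitial ∧ A.lang = L}

end RevWA


namespace RevWA

/-- Recognition of a language by a finite monoid whose idempotents commute:
a finite monoid `M` with commuting idempotents, a monoid homomorphism
`φ : FreeMonoid α →* M`, and a subset `T ⊆ M` with `L = φ⁻¹(T)`. -/
structure EComRecognizer (α : Type) (L : Set (List α)) : Type 1 where
  M : Type
  [fintypeM : Fintype M]
  [monoidM : Monoid M]
  idemComm : ∀ e f : M, e * e = e → f * f = f → e * f = f * e
  φ : FreeMonoid α →* M
  T : Set M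
  recog : L = {w : List α | φ (FreeMonoid.ofList w) ∈ T}

end RevWA

namespace RevWA

section CommutingIdempotents

variable {M : Type} [Monoid M]

/-- The value of the factor between positions `i` and `j` of the sequence `x`, with the
element `f k` inserted at each position `k` of that factor. -/
def decorated (f x : ℕ → M) (i : ℕ) : ℕ → M
  | 0 => f 0
  | j + 1 => if i ≤ j then decorated f x i j * x j * f (j + 1) else f (j + 1)

lemma decorated_self (f x : ℕ → M) (i : ℕ) : decorated f x i i = f i := by
  cases i <;> simp [decorated]

lemma decorated_succ (f x : ℕ → M) {i j : ℕ} (h : i ≤ j) :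
    decorated f x i (j + 1) = decorated f x i j * x j * f (j + 1) := by
  simp [decorated, h]

lemma decorated_mul (f x : ℕ → M) (hf : ∀ k, f k * f k = f k) {i j k : ℕ}
    (hij : i ≤ j) (hjk : j ≤ k) :
    decorated f x i j * decorated f x j k = decorated f x i k := by
  induction k, hjk using Nat.le_induction with
  | base =>
    rw [decorated_self]
    rcases hij.eq_or_lt with rfl | h
    · rw [decorated_self, hf]
    · obtain ⟨m, rfl⟩ : ∃ m, j = m + 1 := ⟨j - 1, by omega⟩
      rw [decorated_succ _ _ (by omega), mul_assoc, hf]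
  | succ k hk ih =>
    rw [decorated_succ _ _ hk, decorated_succ _ _ (hij.trans hk), ← ih]
    simp only [mul_assoc]

lemma decorated_congr {f g : ℕ → M} (x : ℕ → M) {i j : ℕ} (hij : i ≤ j)
    (h : ∀ k, i ≤ k → k ≤ j → f k = g k) : decorated f x i j = decorated g x i j := by
  induction j, hij using Nat.le_induction with
  | base => rw [decorated_self, decorated_self, h i le_rfl le_rfl]
  | succ j hj ih =>
    rw [decorated_succ _ _ hj, decorated_succ _ _ hj, ih fun k h1 h2 => h k h1 (by omega),
      h (j + 1) (by omega) le_rfl]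

lemma decorated_update (f x : ℕ → M) (hf : ∀ k, f k * f k = f k)
    (hM : ∀ e f : M, e * e = e → f * f = f → e * f = f * e) {k n : ℕ} (hk : k ≤ n) {e : M}
    (he : e * e = e) (hf' : ∀ l, Function.update f k (f k * e) l *
      Function.update f k (f k * e) l = Function.update f k (f k * e) l) :
    decorated (Function.update f k (f k * e)) x 0 n =
      decorated f x 0 k * e * decorated f x k n := by
  have h1 : decorated (Function.update f k (f k * e)) x 0 k = decorated f x 0 k * e := by
    cases k with
    | zero => simp [decorated]
    | succ m =>
      rw [decorated_succ _ _ (by omega), decorated_succ _ _ (by omega), Function.update_self,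
        decorated_congr x (Nat.zero_le m) (g := f)]
      · simp only [mul_assoc]
      · intro l _ hl
        exact Function.update_of_ne (by omega) _ _
  have h2 : decorated (Function.update f k (f k * e)) x k n = e * decorated f x k n := by
    clear h1
    induction n, hk using Nat.le_induction with
    | base => rw [decorated_self, decorated_self, Function.update_self, hM _ _ (hf k) he]
    | succ n hn ih =>
      rw [decorated_succ _ _ hn, decorated_succ _ _ hn, ih, Function.update_of_ne (by omega)]
      simp only [mul_assoc]
  rw [← decorated_mul _ x hf' (Nat.zero_le k) hk, h1, h2, ← mul_assoc, mul_assoc _ e e, he]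

/-- A multiplicative family of elements `D i j` refining the factors of the sequence `x`,
in which no idempotent can be inserted any more without changing the total value `D 0 n`,
except those absorbed already. -/
structure Saturated (x : ℕ → M) (n : ℕ) (D : ℕ → ℕ → M) : Prop where
  idem : ∀ k, D k k * D k k = D k k
  mul : ∀ {i j k}, i ≤ j → j ≤ k → D i j * D j k = D i k
  succ : ∀ i, D i (i + 1) = D i i * x i * D (i + 1) (i + 1)
  sat : ∀ {k e}, k ≤ n → e * e = e → D 0 k * e * D k n = D 0 n → D k k * e = D k k

theorem exists_saturated [Finite M]
    (hM : ∀ e f : M, e * e = e → f * f = f → e * f = f * e) (x : ℕ → M) (n : ℕ) :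
    ∃ D, Saturated x n D ∧ D 0 n = ((List.range n).map x).prod := by
  classical
  have := Fintype.ofFinite M
  let W := ((List.range n).map x).prod
  let fixed : M → Finset M := fun e => Finset.univ.filter fun y => e * y = y
  let size : (ℕ → M) → ℕ := fun f => ∑ k ∈ Finset.range (n + 1), (fixed (f k)).card
  let S : Set (ℕ → M) := {f | (∀ k, f k * f k = f k) ∧ decorated f x 0 n = W}
  have hS : S.Nonempty := by
    refine ⟨fun _ => 1, fun _ => one_mul 1, ?_⟩
    have : ∀ m, decorated (fun _ => (1 : M)) x 0 m = ((List.range m).map x).prod := by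
      intro m
      induction m with
      | zero => simp [decorated]
      | succ m ih => rw [decorated_succ _ _ (by omega), ih]; simp [List.range_succ]
    exact this n
  obtain ⟨f, ⟨hf, hW⟩, hmin⟩ : ∃ f ∈ S, ∀ g ∈ S, size f ≤ size g :=
    ⟨_, Function.argminOn_mem size S hS, fun g hg => Function.argminOn_le size S hg⟩
  refine ⟨decorated f x, ⟨?_, ?_, ?_, ?_⟩, hW⟩
  · intro k; rw [decorated_self, hf]
  · intro i j k; exact decorated_mul f x hf
  · intro i; rw [decorated_succ _ _ le_rfl, decorated_self, decorated_self]
  · intro k e hk he h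
    rw [decorated_self]
    by_contra hne
    have hfe : f k * e * (f k * e) = f k * e := by
      rw [mul_assoc, ← mul_assoc e, ← hM _ _ (hf k) he, mul_assoc (f k) e e, he, ← mul_assoc, hf]
    have hg : ∀ l, Function.update f k (f k * e) l * Function.update f k (f k * e) l =
        Function.update f k (f k * e) l := by
      intro l
      rcases eq_or_ne l k with rfl | hl
      · simpa using hfe
      · simpa [Function.update_of_ne hl] using hf l
    have hle := hmin (Function.update f k (f k * e))
      ⟨hg, by rw [decorated_update f x hf hM hk he hg, h, hW]⟩
    refine hle.not_gt (Finset.sum_lt_sum (fun l _ => ?_) ⟨k, by simpa using by omega, ?_⟩)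
    · rcases eq_or_ne l k with rfl | hl
      · refine Finset.card_le_card fun y hy => ?_
        simp only [fixed, Function.update_self, Finset.mem_filter, Finset.mem_univ, true_and]
          at hy ⊢
        rw [← hy, ← mul_assoc, ← mul_assoc, hf]
      · rw [Function.update_of_ne hl]
    · refine Finset.card_lt_card ((Finset.ssubset_iff_of_subset fun y hy => ?_).2 ⟨f k, ?_, ?_⟩)
      · simp only [fixed, Function.update_self, Finset.mem_filter, Finset.mem_univ, true_and]
          at hy ⊢
        rw [← hy, ← mul_assoc, ← mul_assoc, hf]
      · simp [fixed, hf]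
      · simp only [fixed, Function.update_self, Finset.mem_filter, Finset.mem_univ, true_and]
        rwa [mul_assoc, ← hM _ _ (hf k) he, ← mul_assoc, hf]

lemma exists_idempotent_pow [Finite M] (y : M) :
    ∃ m, y ^ (m + 1) * y ^ (m + 1) = y ^ (m + 1) := by
  obtain ⟨a, b, hab, h⟩ : ∃ a b : ℕ, a < b ∧ y ^ a = y ^ b := by
    obtain ⟨a, b, hne, h⟩ := Finite.exists_ne_map_eq_of_infinite fun k : ℕ => y ^ k
    rcases hne.lt_or_gt with hlt | hlt
    exacts [⟨a, b, hlt, h⟩, ⟨b, a, hlt, h.symm⟩]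
  obtain ⟨p, rfl⟩ : ∃ p, b = a + (p + 1) := ⟨b - a - 1, by omega⟩
  have step : ∀ k, y ^ (a + k * (p + 1)) = y ^ a := by
    intro k
    induction k with
    | zero => simp
    | succ k ih => rw [add_mul, one_mul, ← add_assoc, pow_add, ih, ← pow_add, ← h]
  refine ⟨a * (p + 1) + p, ?_⟩
  have h1 : a * (p + 1) + p + 1 = (a * p + p + 1) + a := by ring
  have h2 : a * (p + 1) + p + 1 = (a + 1) * (p + 1) := by ring
  rw [← pow_add]
  nth_rewrite 1 [h1]
  rw [h2, add_assoc, pow_add, step, ← pow_add, ← h2, h1]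

namespace Saturated

variable {x : ℕ → M} {n : ℕ} {D : ℕ → ℕ → M}

lemma left_mul (h : Saturated x n D) {i j : ℕ} (hij : i ≤ j) : D i i * D i j = D i j :=
  h.mul le_rfl hij

lemma mul_right (h : Saturated x n D) {i j : ℕ} (hij : i ≤ j) : D i j * D j j = D i j :=
  h.mul hij le_rfl

lemma eq_left (h : Saturated x n D) {i j : ℕ} (hij : i ≤ j) (hj : j ≤ n)
    (hD : D i j * D i j = D i j) : D i j = D i i := by
  have := h.sat (hij.trans hj) hD (by
    rw [← h.mul hij hj, mul_assoc, ← mul_assoc (D i j), hD, h.mul hij hj,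
      h.mul (Nat.zero_le _) (hij.trans hj)])
  rwa [h.left_mul hij] at this

lemma eq_right (h : Saturated x n D) (hM : ∀ e f : M, e * e = e → f * f = f → e * f = f * e)
    {i j : ℕ} (hij : i ≤ j) (hj : j ≤ n) (hD : D i j * D i j = D i j) : D i j = D j j := by
  have := h.sat hj hD (by
    rw [← h.mul (Nat.zero_le _) hij, mul_assoc (D 0 i), hD, h.mul (Nat.zero_le _) hij,
      h.mul (Nat.zero_le _) hj])
  rwa [hM _ _ (h.idem j) hD, h.mul_right hij] at this

/-- Inside a factor with idempotent value, the two parts are mutually inverse. -/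
lemma inner (h : Saturated x n D) (hM : ∀ e f : M, e * e = e → f * f = f → e * f = f * e)
    {i k j : ℕ} (hik : i ≤ k) (hkj : k ≤ j) (hj : j ≤ n) (hD : D i j * D i j = D i j) :
    D k j * D i k = D k k := by
  have hl := h.eq_left (hik.trans hkj) hj hD
  have hr := h.eq_right hM (hik.trans hkj) hj hD
  have hb : D i j * D i k = D i k := by rw [hl, h.left_mul hik]
  have hidem : D k j * D i k * (D k j * D i k) = D k j * D i k := by
    rw [mul_assoc, ← mul_assoc (D i k), h.mul hik hkj, hb]
  have := h.sat (hkj.trans hj) hidem (by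
    rw [← h.mul (Nat.zero_le _) hik, ← h.mul hkj hj]
    calc D 0 i * D i k * (D k j * D i k) * (D k j * D j n)
        = D 0 i * (D i k * D k j) * (D i k * D k j) * D j n := by simp only [mul_assoc]
      _ = D 0 n := by
        rw [h.mul hik hkj, mul_assoc (D 0 i), hD, h.mul (Nat.zero_le _) (hik.trans hkj),
          h.mul (Nat.zero_le _) hj])
  rwa [← mul_assoc, h.left_mul hkj] at this

lemma fold_forward (h : Saturated x n D)
    (hM : ∀ e f : M, e * e = e → f * f = f → e * f = f * e)
    {i j : ℕ} (hij : i < j) (hj : j + 1 ≤ n) (hx : x i = x j) (hD : D i j * D i j = D i j) :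
    D (i + 1) (j + 1) * D (i + 1) (j + 1) = D (i + 1) (j + 1) := by
  have hl := h.eq_left hij.le (by omega) hD
  have hr := h.eq_right hM hij.le (by omega) hD
  have hin := h.inner hM (k := i + 1) (Nat.le_succ i) hij (by omega) hD
  have hc := h.mul_right (i := i + 1) (j := j) hij
  have h1 : D (i + 1) j * x j * D (i + 1) (i + 1) = D (i + 1) (i + 1) := by
    rw [← hx]
    nth_rewrite 2 [← hin]
    rw [h.succ i, ← hl, hr]
    nth_rewrite 1 [← hc]
    simp only [mul_assoc]
  have h2 : D (i + 1) (i + 1) * (D (i + 1) j * x j) = D (i + 1) j * x j := by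
    rw [← mul_assoc, h.left_mul hij]
  have h3 : D (i + 1) j * x j * (D (i + 1) j * x j) = D (i + 1) j * x j := by
    nth_rewrite 2 [← h2]
    rw [← mul_assoc (D (i + 1) j * x j), h1, h2]
  have h4 : D (i + 1) j * x j = D (i + 1) (i + 1) := by
    rw [← h1, hM _ _ h3 (h.idem _), h2]
  have h5 : D (i + 1) (j + 1) = D (i + 1) (i + 1) * D (j + 1) (j + 1) := by
    rw [← h.mul (i := i + 1) (j := j) hij (Nat.le_succ j), h.succ j, ← mul_assoc, ← mul_assoc,
      hc, h4]
  rw [h5, mul_assoc, ← mul_assoc (D (j + 1) (j + 1)), hM _ _ (h.idem (j + 1)) (h.idem (i + 1)),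
    mul_assoc, h.idem, ← mul_assoc, h.idem]

lemma fold_backward (h : Saturated x n D)
    (hM : ∀ e f : M, e * e = e → f * f = f → e * f = f * e)
    {i j : ℕ} (hij : i < j) (hj : j + 1 ≤ n) (hx : x i = x j)
    (hD : D (i + 1) (j + 1) * D (i + 1) (j + 1) = D (i + 1) (j + 1)) :
    D i j * D i j = D i j := by
  have hl := h.eq_left (by omega) hj hD
  have hr := h.eq_right hM (by omega) hj hD
  have hin := h.inner hM (i := i + 1) (k := j) hij (Nat.le_succ j) hj hD
  have hc := h.left_mul (i := i + 1) (j := j) hij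
  have h1 : D j j * (x i * D (i + 1) j) = D j j := by
    rw [hx]
    nth_rewrite 2 [← hin]
    rw [h.succ j, ← hr, hl]
    nth_rewrite 1 [← hc]
    simp only [mul_assoc]
  have h2 : (x i * D (i + 1) j) * D j j = x i * D (i + 1) j := by
    rw [mul_assoc, h.mul_right hij]
  have h3 : x i * D (i + 1) j * (x i * D (i + 1) j) = x i * D (i + 1) j := by
    nth_rewrite 1 [← h2]
    rw [mul_assoc (x i * D (i + 1) j), h1, h2]
  have h4 : x i * D (i + 1) j = D j j := by
    rw [← h1, hM _ _ (h.idem _) h3, h2]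
  have h5 : D i j = D i i * D j j := by
    rw [← h.mul (i := i) (j := i + 1) (Nat.le_succ i) hij, h.succ i, mul_assoc, hc, mul_assoc, h4]
  rw [h5, mul_assoc, ← mul_assoc (D j j), hM _ _ (h.idem j) (h.idem i),
    mul_assoc, h.idem, ← mul_assoc, h.idem]

/-- Two positions are linked when the factor between them has idempotent value. -/
def Linked (D : ℕ → ℕ → M) (i j : ℕ) : Prop :=
  D (min i j) (max i j) * D (min i j) (max i j) = D (min i j) (max i j)

lemma linked_of_le {i j : ℕ} (hij : i ≤ j) : Linked D i j ↔ D i j * D i j = D i j := by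
  simp [Linked, hij]

lemma linked_symm {i j : ℕ} (hij : Linked D i j) : Linked D j i := by
  rwa [Linked, min_comm, max_comm]

lemma linked_refl (h : Saturated x n D) (i : ℕ) : Linked D i i :=
  (linked_of_le le_rfl).2 (h.idem i)

lemma linked_trans (h : Saturated x n D)
    (hM : ∀ e f : M, e * e = e → f * f = f → e * f = f * e) {i j k : ℕ}
    (hi : i ≤ n) (hj : j ≤ n) (hk : k ≤ n) (hij : Linked D i j) (hjk : Linked D j k) :
    Linked D i k := by
  have cat : ∀ {a b c : ℕ}, a ≤ b → b ≤ c → c ≤ n → Linked D a b → Linked D b c →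
      Linked D a c := by
    intro a b c hab hbc hc h1 h2
    rw [linked_of_le hab] at h1
    rw [linked_of_le hbc] at h2
    rw [linked_of_le (hab.trans hbc), ← h.mul hab hbc, h.eq_left hbc hc h2, h.mul_right hab, h1]
  have cancel_left : ∀ {a b c : ℕ}, a ≤ b → b ≤ c → c ≤ n → Linked D a b → Linked D a c →
      Linked D b c := by
    intro a b c hab hbc hc h1 h2
    rw [linked_of_le hab] at h1
    rw [linked_of_le (hab.trans hbc)] at h2
    have : D b c = D a c := by
      rw [← h.mul hab hbc, h.eq_right hM hab (hbc.trans hc) h1, h.left_mul hbc]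
    rw [linked_of_le hbc, this, h2]
  have cancel_right : ∀ {a b c : ℕ}, a ≤ b → b ≤ c → c ≤ n → Linked D b c → Linked D a c →
      Linked D a b := by
    intro a b c hab hbc hc h1 h2
    rw [linked_of_le hbc] at h1
    rw [linked_of_le (hab.trans hbc)] at h2
    have : D a b = D a c := by
      rw [← h.mul hab hbc, h.eq_left hbc hc h1, h.mul_right hab]
    rw [linked_of_le hab, this, h2]
  rcases le_total i j with h1 | h1 <;> rcases le_total j k with h2 | h2 <;>
    rcases le_total i k with h3 | h3
  · exact cat h1 h2 hk hij hjk
  · exact cat h1 h2 hk hij hjk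
  · exact cancel_right h3 h2 hj (linked_symm hjk) hij
  · exact linked_symm (cancel_right h3 h1 hj hij (linked_symm hjk))
  · exact cancel_left h1 h3 hk (linked_symm hij) hjk
  · exact linked_symm (cancel_left h2 h3 hi hjk (linked_symm hij))
  · exact linked_symm (cat h2 h1 hi (linked_symm hjk) (linked_symm hij))
  · exact linked_symm (cat h2 h1 hi (linked_symm hjk) (linked_symm hij))

lemma linked_succ_iff (h : Saturated x n D)
    (hM : ∀ e f : M, e * e = e → f * f = f → e * f = f * e) {i j : ℕ}
    (hi : i + 1 ≤ n) (hj : j + 1 ≤ n) (hx : x i = x j) :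
    Linked D i j ↔ Linked D (i + 1) (j + 1) := by
  have key : ∀ {a b : ℕ}, a < b → b + 1 ≤ n → x a = x b →
      (Linked D a b ↔ Linked D (a + 1) (b + 1)) := by
    intro a b hab hb hx
    rw [linked_of_le hab.le, linked_of_le (by omega)]
    exact ⟨h.fold_forward hM hab hb hx, h.fold_backward hM hab hb hx⟩
  rcases lt_trichotomy i j with hij | rfl | hij
  · exact key hij hj hx
  · exact iff_of_true (h.linked_refl _) (h.linked_refl _)
  · have := key hij hi hx.symm
    exact ⟨fun H => linked_symm (this.1 (linked_symm H)),
      fun H => linked_symm (this.2 (linked_symm H))⟩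

/-- If two prefixes have the same value then the factor between them generates a group. -/
lemma exists_pow_eq [Finite M] (h : Saturated x n D)
    (hM : ∀ e f : M, e * e = e → f * f = f → e * f = f * e)
    {i j : ℕ} (hij : i ≤ j) (hj : j ≤ n) (hP : D 0 i = D 0 j) :
    D i i = D j j ∧ ∃ m, D i j ^ (m + 1) = D i i := by
  obtain ⟨m, hm⟩ := exists_idempotent_pow (D i j)
  set g := D i j ^ (m + 1) with hg
  have hfix : ∀ m, D 0 i * D i j ^ m = D 0 i := by
    intro m
    induction m with
    | zero => simp
    | succ m ih => rw [pow_succ', ← mul_assoc, h.mul (Nat.zero_le _) hij, ← hP, ih]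
  have hi := h.sat (hij.trans hj) hm (by
    rw [hg, hfix, h.mul (Nat.zero_le _) (hij.trans hj)])
  have hj' := h.sat hj hm (by
    rw [← hP, hg, hfix, hP, h.mul (Nat.zero_le _) hj])
  have hi2 : D i i * g = g := by rw [hg, pow_succ', ← mul_assoc, h.left_mul hij]
  have hj2 : g * D j j = g := by rw [hg, pow_succ, mul_assoc, h.mul_right hij]
  rw [hM _ _ (h.idem j) hm, hj2] at hj'
  exact ⟨by rw [← hi, hi2, hj'], m, by rw [← hi, hi2]⟩

/-- The number of classes of linked positions is bounded in terms of the monoid only. -/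
lemma exists_key [Finite M] (h : Saturated x n D)
    (hM : ∀ e f : M, e * e = e → f * f = f → e * f = f * e) :
    ∃ key : ℕ → M × M, ∀ i ≤ n, ∀ j ≤ n, key i = key j → Linked D i j := by
  let key : ℕ → M × M := fun i => (D 0 i, D (sInf {l | D 0 l = D 0 i}) i)
  have main : ∀ i j, i ≤ j → j ≤ n → key i = key j → Linked D i j := by
    intro i j hij hj hk
    obtain ⟨h1, h2⟩ := Prod.ext_iff.1 hk
    simp only [key] at h1 h2
    rw [← h1] at h2
    set b := sInf {l | D 0 l = D 0 i} with hb
    have hb0 : D 0 b = D 0 i := Nat.sInf_mem (s := {l | D 0 l = D 0 i}) ⟨i, rfl⟩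
    have hbi : b ≤ i := Nat.sInf_le rfl
    obtain ⟨h3, m, hm⟩ := h.exists_pow_eq hM hbi (hij.trans hj) hb0
    have h4 : D i j = D i i := by
      rw [← h.left_mul hij, ← h3, ← hm, pow_succ, mul_assoc, h.mul hbi hij, h2]
    rw [linked_of_le hij, h4, h.idem]
  refine ⟨key, fun i hi j hj hk => ?_⟩
  rcases le_total i j with hij | hij
  · exact main i j hij hj hk
  · exact linked_symm (main j i hij hi hk.symm)

end Saturated

end CommutingIdempotents

lemma exists_perm_extending {I K : Type} [Finite K] (s t : I → K)
    (h : ∀ i j, s i = s j ↔ t i = t j) : ∃ σ : Equiv.Perm K, ∀ i, σ (s i) = t i := by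
  classical
  have := Fintype.ofFinite K
  let e : {k // k ∈ Set.range s} → {k // k ∈ Set.range t} :=
    fun k => ⟨t k.2.choose, Set.mem_range_self _⟩
  have he : ∀ i, (e ⟨s i, Set.mem_range_self i⟩ : K) = t i := fun i =>
    (h _ _).1 (Exists.choose_spec (Set.mem_range_self (f := s) i))
  have hbij : Function.Bijective e := by
    constructor
    · rintro ⟨_, i, rfl⟩ ⟨_, j, rfl⟩ hij
      have := congrArg Subtype.val hij
      rw [he, he] at this
      exact Subtype.ext ((h i j).2 this)
    · rintro ⟨_, i, rfl⟩
      exact ⟨⟨s i, Set.mem_range_self i⟩, Subtype.ext (he i)⟩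
  refine ⟨(Equiv.ofBijective e hbij).extendSubtype, fun i => ?_⟩
  rw [Equiv.extendSubtype_apply_of_mem _ _ (Set.mem_range_self i)]
  exact he i

section Groups

variable {M α : Type} [Monoid M] [Finite M]

/-- Words with non-idempotent value are mapped to a nontrivial permutation of a set whose size
depends on the monoid only. -/
lemma exists_perm_ne_one (hM : ∀ e f : M, e * e = e → f * f = f → e * f = f * e) (φ : α → M)
    (w : List α) (hw : (w.map φ).prod * (w.map φ).prod ≠ (w.map φ).prod) :
    ∃ σ : α → Equiv.Perm (M × M), (w.map σ).prod ≠ 1 := by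
  let x : ℕ → M := fun k => (w.map φ).getD k 1
  obtain ⟨D, hD, hD0⟩ := exists_saturated hM x w.length
  have hprod : (List.range w.length).map x = w.map φ := by
    refine List.ext_getElem (by simp) fun k h1 h2 => ?_
    simp only [List.getElem_map, List.getElem_range, x]
    rw [List.getD_eq_getElem _ _ h2, List.getElem_map]
  rw [hprod] at hD0
  obtain ⟨key, hkey⟩ := hD.exists_key hM
  let rep : ℕ → ℕ := fun i => sInf {l | l ≤ w.length ∧ Saturated.Linked D l i}
  have hrep : ∀ i ≤ w.length, rep i ≤ w.length ∧ Saturated.Linked D (rep i) i := fun i hi =>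
    Nat.sInf_mem (s := {l | l ≤ w.length ∧ Saturated.Linked D l i}) ⟨i, hi, hD.linked_refl i⟩
  let κ : ℕ → M × M := fun i => key (rep i)
  have hκ : ∀ i ≤ w.length, ∀ j ≤ w.length, κ i = κ j ↔ Saturated.Linked D i j := by
    intro i hi j hj
    obtain ⟨hri, hli⟩ := hrep i hi
    obtain ⟨hrj, hlj⟩ := hrep j hj
    constructor
    · intro h
      have h1 := hkey _ hri _ hrj h
      exact hD.linked_trans hM hi hri hj (Saturated.linked_symm hli)
        (hD.linked_trans hM hri hrj hj h1 hlj)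
    · intro h
      have : rep i = rep j := by
        refine congrArg sInf (Set.ext fun l => and_congr_right fun hl => ⟨fun h1 => ?_, fun h1 => ?_⟩)
        · exact hD.linked_trans hM hl hi hj h1 h
        · exact hD.linked_trans hM hl hj hi h1 (Saturated.linked_symm h)
      exact congrArg key this
  have hσ : ∀ a, ∃ σ : Equiv.Perm (M × M), ∀ k : {k : Fin w.length // w[k] = a},
      σ (κ (k.1 + 1)) = κ k.1 := by
    intro a
    refine exists_perm_extending (fun k : {k : Fin w.length // w[k] = a} => κ (k.1 + 1))
      (fun k => κ k.1) ?_
    rintro ⟨⟨k, hk⟩, hka⟩ ⟨⟨l, hl⟩, hla⟩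
    have hka : w[k] = a := hka
    have hla : w[l] = a := hla
    have hx : x k = x l := by simp [x, hk, hl, hka, hla]
    exact (hκ _ hk _ hl).trans
      ((hD.linked_succ_iff hM hk hl hx).symm.trans (hκ _ hk.le _ hl.le).symm)
  choose σ hσ using hσ
  have hwalk : ∀ k ≤ w.length, ((w.take k).map σ).prod (κ k) = κ 0 := by
    intro k
    induction k with
    | zero => simp
    | succ k ih =>
      intro hk
      have h1 := hσ w[k] ⟨⟨k, hk⟩, rfl⟩
      rw [List.take_succ_eq_append_getElem hk]
      simp only [List.map_append, List.map_cons, List.map_nil, List.prod_append,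
        List.prod_singleton, Equiv.Perm.mul_apply]
      rw [h1, ih (by omega)]
  refine ⟨σ, fun h1 => hw ?_⟩
  have := hwalk _ le_rfl
  rw [List.take_length, h1, Equiv.Perm.one_apply, eq_comm, hκ _ (Nat.zero_le _) _ le_rfl,
    Saturated.linked_of_le (Nat.zero_le _), hD0] at this
  exact this

theorem exists_group [Finite α] (hM : ∀ e f : M, e * e = e → f * f = f → e * f = f * e)
    (φ : α → M) : ∃ (G : Type) (_ : Group G) (_ : Finite G) (ψ : α → G), ∀ w : List α,
      (w.map ψ).prod = 1 → (w.map φ).prod * (w.map φ).prod = (w.map φ).prod := by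
  refine ⟨(α → Equiv.Perm (M × M)) → Equiv.Perm (M × M), inferInstance, inferInstance,
    fun a σ => σ a, fun w hw => ?_⟩
  by_contra hne
  obtain ⟨σ, hσ⟩ := exists_perm_ne_one hM φ w hne
  apply hσ
  have := congrArg (Pi.evalMonoidHom (fun _ : α → Equiv.Perm (M × M) => Equiv.Perm (M × M)) σ) hw
  rw [map_list_prod, List.map_map] at this
  simpa [Function.comp_def] using this

end Groups

section Cayley

variable {M G α : Type} [Monoid M] [Group G]

/-- The edges of the Cayley graph of `G` used by the path labelled by a word. -/
def edges (ψ : α → G) : G → List α → Set (G × α)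
  | _, [] => ∅
  | g, a :: w => insert (g, a) (edges ψ (g * ψ a) w)

lemma edges_append (ψ : α → G) (g : G) (u v : List α) :
    edges ψ g (u ++ v) = edges ψ g u ∪ edges ψ (g * (u.map ψ).prod) v := by
  induction u generalizing g with
  | nil => simp [edges]
  | cons a u ih => simp [edges, ih, Set.insert_union, mul_assoc]

lemma exists_of_mem_edges {ψ : α → G} {g h : G} {a : α} {w : List α}
    (hw : (h, a) ∈ edges ψ g w) : ∃ u v, w = u ++ a :: v ∧ h = g * (u.map ψ).prod := by
  induction w generalizing g with
  | nil => simp [edges] at hw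
  | cons b w ih =>
    rcases hw with hw | hw
    · obtain ⟨rfl, rfl⟩ := Prod.ext_iff.1 hw
      exact ⟨[], w, by simp, by simp⟩
    · obtain ⟨u, v, rfl, rfl⟩ := ih hw
      exact ⟨b :: u, v, by simp, by simp [mul_assoc]⟩

variable {φ : α → M} {ψ : α → G}

lemma exists_return
    (hφ : ∀ w : List α, (w.map ψ).prod = 1 →
      (w.map φ).prod * (w.map φ).prod = (w.map φ).prod)
    (g : G) (x y : List α) (hy : edges ψ (g * (x.map ψ).prod) y ⊆ edges ψ g x) :
    ∃ z : List α, (y.map ψ).prod * (z.map ψ).prod = 1 ∧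
      (x.map φ).prod * (y.map φ).prod * (z.map φ).prod = (x.map φ).prod := by
  induction y generalizing x with
  | nil => exact ⟨[], by simp, by simp⟩
  | cons a y ih =>
    obtain ⟨u, v, rfl, hu⟩ := exists_of_mem_edges (hy (Set.mem_insert _ _))
    have hloop : ((a :: v).map ψ).prod = 1 := by
      simpa using mul_left_cancel hu
    have hidem := hφ _ hloop
    obtain ⟨z, hz1, hz2⟩ := ih (u ++ a :: v ++ [a]) (by
      rw [edges_append _ _ (u ++ a :: v)]
      refine Set.Subset.trans ?_ Set.subset_union_left
      refine Set.Subset.trans ?_ hy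
      simp [edges, mul_assoc])
    refine ⟨z ++ v, ?_, ?_⟩
    · simp only [List.map_cons, List.prod_cons, List.map_append, List.prod_append] at hloop ⊢
      rw [← mul_assoc, mul_assoc (ψ a), hz1, mul_one, hloop]
    · simp only [List.map_cons, List.prod_cons, List.map_append, List.prod_append, List.map_nil,
        List.prod_nil, mul_one] at hz2 hidem ⊢
      calc _ = ((u.map φ).prod * (φ a * (v.map φ).prod) * φ a * (y.map φ).prod * (z.map φ).prod)
            * (v.map φ).prod := by simp only [mul_assoc]
        _ = (u.map φ).prod * ((φ a * (v.map φ).prod) * (φ a * (v.map φ).prod)) := by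
            rw [hz2]; simp only [mul_assoc]
        _ = _ := by rw [hidem]

variable (hM : ∀ e f : M, e * e = e → f * f = f → e * f = f * e)
  (hφ : ∀ w : List α, (w.map ψ).prod = 1 → (w.map φ).prod * (w.map φ).prod = (w.map φ).prod)

include hM hφ in
/-- A loop can be absorbed by a path using all of its edges. -/
lemma absorb_loop (g : G) (x y : List α) (hy : edges ψ (g * (x.map ψ).prod) y ⊆ edges ψ g x)
    (h1 : (y.map ψ).prod = 1) : (x.map φ).prod * (y.map φ).prod = (x.map φ).prod := by
  obtain ⟨z, hz1, hz2⟩ := exists_return hφ g x y hy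
  have hyi := hφ y h1
  rw [h1, one_mul] at hz1
  have hcomm := hM _ _ (hφ z hz1) hyi
  calc (x.map φ).prod * (y.map φ).prod
      = (x.map φ).prod * (y.map φ).prod * (z.map φ).prod * (y.map φ).prod := by rw [hz2]
    _ = (x.map φ).prod * ((y.map φ).prod * (y.map φ).prod) * (z.map φ).prod := by
      rw [mul_assoc, hcomm]; simp only [mul_assoc]
    _ = _ := by rw [hyi, hz2]

include hM hφ in
lemma prod_eq_of_return (g : G) (u v z : List α) (he : edges ψ g u = edges ψ g v)
    (hψ : (u.map ψ).prod = (v.map ψ).prod) (hz : (u.map ψ).prod * (z.map ψ).prod = 1)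
    (hz' : edges ψ (g * (u.map ψ).prod) z ⊆ edges ψ g u) :
    (u.map φ).prod = (v.map φ).prod := by
  have hz2 : (z.map ψ).prod * (u.map ψ).prod = 1 := mul_eq_one_comm.1 hz
  have absorb : ∀ p q : List α, edges ψ g p = edges ψ g u → edges ψ g q = edges ψ g u →
      (p.map ψ).prod = (u.map ψ).prod → (q.map ψ).prod = (u.map ψ).prod →
      (p.map φ).prod * ((z.map φ).prod * (q.map φ).prod) = (p.map φ).prod := by
    intro p q hp hq hp' hq'
    rw [← List.prod_append, ← List.map_append]
    refine absorb_loop hM hφ g p (z ++ q) ?_ ?_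
    · rw [edges_append, hp', mul_assoc, hz, mul_one, hp, hq]
      exact Set.union_subset hz' le_rfl
    · rw [List.map_append, List.prod_append, hq', hz2]
  have huv := absorb u v rfl he.symm rfl hψ.symm
  have huu := absorb u u rfl rfl rfl rfl
  have hvu := absorb v u he.symm rfl hψ.symm rfl
  have hu := hφ (u ++ z) (by rw [List.map_append, List.prod_append, hz])
  have hv := hφ (v ++ z) (by rw [List.map_append, List.prod_append, ← hψ, hz])
  have hcomm := hM _ _ hu hv
  simp only [List.map_append, List.prod_append] at hcomm
  calc (u.map φ).prod = (u.map φ).prod * (z.map φ).prod * ((v.map φ).prod * (z.map φ).prod)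
        * (u.map φ).prod := by
        nth_rewrite 1 [← huv]; nth_rewrite 1 [← hvu]; simp only [mul_assoc]
    _ = (v.map φ).prod * ((z.map φ).prod * ((u.map φ).prod *
        ((z.map φ).prod * (u.map φ).prod))) := by rw [hcomm]; simp only [mul_assoc]
    _ = (v.map φ).prod := by rw [huu, hvu]

lemma exists_split (R : G → Prop) (g : G) (u : List α) (hg : R g)
    (hu : ¬ R (g * (u.map ψ).prod)) :
    ∃ u₀ a u₁, u = u₀ ++ a :: u₁ ∧ R (g * (u₀.map ψ).prod) ∧
      ¬ R (g * (u₀.map ψ).prod * ψ a) ∧ ∀ h b, (h, b) ∈ edges ψ g u₀ → R (h * ψ b) := by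
  induction u generalizing g with
  | nil => simp [hg] at hu
  | cons a u ih =>
    by_cases ha : R (g * ψ a)
    · obtain ⟨u₀, b, u₁, rfl, h1, h2, h3⟩ := ih (g * ψ a) ha (by simpa [mul_assoc] using hu)
      refine ⟨a :: u₀, b, u₁, by simp, by simpa [mul_assoc] using h1,
        by simpa [mul_assoc] using h2, ?_⟩
      rintro h c (hc | hc)
      · obtain ⟨rfl, rfl⟩ := Prod.ext_iff.1 hc
        exact ha
      · exact h3 h c hc
    · exact ⟨[], a, u, by simp, by simpa using hg, by simpa using ha, by simp [edges]⟩

lemma not_of_mem_edges {R : G → Prop} {C : Set (G × α)}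
    (hR : ∀ h b, (h, b) ∈ C → R (h * ψ b) → R h) (g : G) (u : List α) (hg : ¬ R g)
    (hu : edges ψ g u ⊆ C) {h : G} {b : α} (hb : (h, b) ∈ edges ψ g u) : ¬ R h := by
  induction u generalizing g with
  | nil => simp [edges] at hb
  | cons a u ih =>
    rcases hb with hb | hb
    · obtain ⟨rfl, rfl⟩ := Prod.ext_iff.1 hb
      exact hg
    · exact ih _ (fun ha => hg (hR _ _ (hu (Set.mem_insert _ _)) ha))
        ((Set.subset_insert _ _).trans hu) hb

/-- A path leaving a set of vertices that it cannot reenter splits at its unique bridge. -/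
lemma exists_bridge {R : G → Prop} {g : G} {w : List α}
    (hR : ∀ h b, (h, b) ∈ edges ψ g w → R (h * ψ b) → R h) (hg : R g)
    (hw : ¬ R (g * (w.map ψ).prod)) :
    ∃ u a v, w = u ++ a :: v ∧
      (∀ h c, ((h, c) ∈ edges ψ g w ∧ R h ∧ ¬ R (h * ψ c)) ↔ (h, c) = (g * (u.map ψ).prod, a)) ∧
      (∀ h c, (h, c) ∈ edges ψ g u ↔ (h, c) ∈ edges ψ g w ∧ R (h * ψ c)) ∧
      (∀ h c, (h, c) ∈ edges ψ (g * (u.map ψ).prod * ψ a) v ↔ (h, c) ∈ edges ψ g w ∧ ¬ R h) := by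
  obtain ⟨u, a, v, rfl, hu1, hu2, hu3⟩ := exists_split (ψ := ψ) R g w hg hw
  have hE : edges ψ g (u ++ a :: v) = edges ψ g u ∪ insert (g * (u.map ψ).prod, a)
      (edges ψ (g * (u.map ψ).prod * ψ a) v) := by rw [edges_append]; rfl
  have hv : ∀ {h c}, (h, c) ∈ edges ψ (g * (u.map ψ).prod * ψ a) v → ¬ R h :=
    not_of_mem_edges hR _ _ hu2 (by
      rw [hE]; exact (Set.subset_insert _ _).trans Set.subset_union_right)
  refine ⟨u, a, v, rfl, fun h c => ⟨fun ⟨hc, h1, h2⟩ => ?_, fun hc => ?_⟩,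
    fun h c => ⟨fun hc => ⟨hE ▸ Or.inl hc, hu3 _ _ hc⟩, fun ⟨hc, hr⟩ => ?_⟩,
    fun h c => ⟨fun hc => ⟨hE ▸ Or.inr (Or.inr hc), hv hc⟩, fun ⟨hc, hr⟩ => ?_⟩⟩
  · rw [hE] at hc
    rcases hc with hc | hc | hc
    · exact absurd (hu3 _ _ hc) h2
    · exact hc
    · exact absurd h1 (hv hc)
  · obtain ⟨rfl, rfl⟩ := Prod.mk.inj hc
    exact ⟨hE ▸ Or.inr (Set.mem_insert _ _), hu1, hu2⟩
  · have hs := hR _ _ hc hr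
    rw [hE] at hc
    rcases hc with hc | hc | hc
    · exact hc
    · obtain ⟨rfl, rfl⟩ := Prod.mk.inj hc
      exact absurd hr hu2
    · exact absurd hs (hv hc)
  · have hc' := hc
    rw [hE] at hc
    rcases hc with hc | hc | hc
    · exact absurd (hR _ _ hc' (hu3 _ _ hc)) hr
    · obtain ⟨rfl, rfl⟩ := Prod.mk.inj hc
      exact absurd hu1 hr
    · exact hc

include hM hφ in
/-- Two paths with the same endpoints and the same edges have the same value. -/
theorem prod_eq_of_edges_eq (g : G) (u v : List α) (he : edges ψ g u = edges ψ g v)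
    (hψ : (u.map ψ).prod = (v.map ψ).prod) : (u.map φ).prod = (v.map φ).prod := by
  induction hn : u.length using Nat.strong_induction_on generalizing g u v with
  | _ n ih =>
  subst hn
  let R : G → Prop := fun x => ∃ z : List α, x * (z.map ψ).prod = g ∧ edges ψ x z ⊆ edges ψ g u
  by_cases hret : R (g * (u.map ψ).prod)
  · obtain ⟨z, hz1, hz2⟩ := hret
    exact prod_eq_of_return hM hφ g u v z he hψ
      (mul_left_cancel (a := g) (by rw [← mul_assoc, hz1, mul_one])) hz2
  have hg : R g := ⟨[], by simp, by simp [edges]⟩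
  have hR : ∀ h b, (h, b) ∈ edges ψ g u → R (h * ψ b) → R h := by
    rintro h b hb ⟨z, hz1, hz2⟩
    exact ⟨b :: z, by simpa [mul_assoc] using hz1, Set.insert_subset hb hz2⟩
  obtain ⟨u₀, a, u₁, hu, hu1, hu2, hu3⟩ := exists_bridge hR hg hret
  obtain ⟨v₀, b, v₁, hv, hv1, hv2, hv3⟩ := exists_bridge (he ▸ hR) hg (hψ ▸ hret)
  obtain ⟨hb, rfl⟩ := Prod.mk.inj ((hv1 _ _).1 (he ▸ (hu1 _ _).2 rfl))
  have h0 : (u₀.map ψ).prod = (v₀.map ψ).prod := mul_left_cancel hb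
  have head : edges ψ g u₀ = edges ψ g v₀ := by
    ext ⟨h, c⟩
    rw [hu2, hv2, he]
  have tail : edges ψ (g * (u₀.map ψ).prod * ψ a) u₁ =
      edges ψ (g * (u₀.map ψ).prod * ψ a) v₁ := by
    ext ⟨h, c⟩
    rw [hu3, hb, hv3, he]
  have h1 : (u₁.map ψ).prod = (v₁.map ψ).prod := by
    rw [hu, hv] at hψ
    simp only [List.map_append, List.map_cons, List.prod_append, List.prod_cons, h0] at hψ
    exact mul_left_cancel (mul_left_cancel hψ)
  have h2 := ih u₀.length (by simp [hu]) g u₀ v₀ head h0 rfl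
  have h3 := ih u₁.length (by simp [hu]; omega) _ u₁ v₁ tail h1 rfl
  rw [hu, hv]
  simp only [List.map_append, List.map_cons, List.prod_append, List.prod_cons, h2, h3]

end Cayley

/-- A reversible linear representation over any finite index type gives a series of `Rev`. -/
lemma mem_Rev_of_fintype {S α Q : Type} [Semiring S] [Fintype Q] [DecidableEq Q]
    (i f : Q → S) (T : α → Matrix Q Q S)
    (hrow : ∀ a p q q', T a p q ≠ 0 → T a p q' ≠ 0 → q = q')
    (hcol : ∀ a p p' q, T a p q ≠ 0 → T a p' q ≠ 0 → p = p') :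
    (fun w : List α => i ⬝ᵥ (w.map T).prod.mulVec f) ∈ Rev S α := by
  let e := Fintype.equivFin Q
  let A : WA S α :=
    ⟨Fintype.card Q, i ∘ e.symm, fun a => (T a).submatrix e.symm e.symm, f ∘ e.symm⟩
  have hA : ∀ w, A.matWord w = (w.map T).prod.submatrix e.symm e.symm := by
    intro w
    induction w with
    | nil => simp [WA.matWord, A]
    | cons a w ih =>
      rw [List.map_cons, List.prod_cons, ← Matrix.submatrix_mul_equiv _ _ e.symm e.symm e.symm,
        ← ih]
      rfl
  refine ⟨A, fun a => ⟨fun p q q' h h' => e.symm.injective (hrow a _ _ _ h h'),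
    fun p p' q h h' => e.symm.injective (hcol a _ _ _ h h')⟩, funext fun w => ?_⟩
  simp only [WA.series, hA, A, Matrix.submatrix_mulVec_equiv]
  simp [Function.comp_assoc]

/-- Over `ZMod 2`, summing over the upper sets of a Boolean lattice is an involution. -/
lemma sum_ge_sum_ge {K : Type} [Fintype K] [DecidableEq K] (F : Finset K → ZMod 2)
    (c : Finset K) :
    ∑ C, (if c ⊆ C then ∑ D, (if C ⊆ D then F D else 0) else 0) = F c := by
  have key : ∀ D, ∑ C, (if c ⊆ C then (if C ⊆ D then F D else 0) else 0) =
      if D = c then F D else 0 := by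
    intro D
    simp only [← ite_and]
    rw [← Finset.sum_filter, Finset.sum_const]
    have hI : (Finset.univ.filter fun C => c ⊆ C ∧ C ⊆ D) = Finset.Icc c D := by
      ext C; simp
    rw [hI]
    split_ifs with h
    · simp [h]
    · by_cases hcD : c ⊆ D
      · have hlt := Finset.card_lt_card (hcD.ssubset_of_ne (Ne.symm h))
        rw [Finset.card_Icc_finset hcD, nsmul_eq_mul, Nat.cast_pow,
          (show ((2 : ℕ) : ZMod 2) = 0 from rfl), zero_pow (by omega), zero_mul]
      · rw [Finset.Icc_eq_empty hcD, Finset.card_empty, zero_smul]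
  calc _ = ∑ C, ∑ D, (if c ⊆ C then (if C ⊆ D then F D else 0) else 0) :=
        Finset.sum_congr rfl fun C _ => by split_ifs <;> simp
    _ = ∑ D, ∑ C, (if c ⊆ C then (if C ⊆ D then F D else 0) else 0) := Finset.sum_comm
    _ = _ := by simp only [key]; simp

section CayleyAutomaton

variable {G α : Type} [Group G]

open Classical in
/-- The transitions of the automaton whose states are a set of allowed edges and a vertex of the
Cayley graph. -/
noncomputable def cayleyTrans (ψ : α → G) (a : α) :
    Matrix (Finset (G × α) × G) (Finset (G × α) × G) (ZMod 2) :=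
  fun p q => if (p.2, a) ∈ p.1 ∧ q = (p.1, p.2 * ψ a) then 1 else 0

open Classical in
lemma cayleyTrans_prod_mulVec [Fintype G] [Fintype α] (ψ : α → G) (w : List α)
    (f : Finset (G × α) × G → ZMod 2) (C : Finset (G × α)) (g : G) :
    (w.map (cayleyTrans ψ)).prod.mulVec f (C, g) =
      if edges ψ g w ⊆ C then f (C, g * (w.map ψ).prod) else 0 := by
  induction w generalizing g with
  | nil => simp [edges]
  | cons a w ih =>
    rw [List.map_cons, List.prod_cons, ← Matrix.mulVec_mulVec]
    by_cases ha : (g, a) ∈ C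
    · simp [Matrix.mulVec, dotProduct, cayleyTrans, ha, edges, Set.insert_subset_iff]
      simpa [mul_assoc, Matrix.mulVec, dotProduct] using ih (g * ψ a)
    · simp [Matrix.mulVec, dotProduct, cayleyTrans, ha, edges, Set.insert_subset_iff]

/-- Every language determined by the edges and the end point of the path of a word in the Cayley
graph of a finite group is the support of a reversible series over `ZMod 2`. -/
lemma mem_RevL_of_edges [Finite G] [Finite α] (ψ : α → G) (L : Set (List α))
    (hL : ∀ u v : List α, edges ψ 1 u = edges ψ 1 v → (u.map ψ).prod = (v.map ψ).prod →
      u ∈ L → v ∈ L) : L ∈ RevL (ZMod 2) α := by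
  classical
  have := Fintype.ofFinite G
  have := Fintype.ofFinite α
  let F : Finset (G × α) → G → ZMod 2 := fun C g =>
    if ∃ u ∈ L, edges ψ 1 u = C ∧ (u.map ψ).prod = g then 1 else 0
  refine ⟨_, mem_Rev_of_fintype (fun p : Finset (G × α) × G => if p.2 = 1 then 1 else 0)
    (fun p => ∑ D, if p.1 ⊆ D then F D p.2 else 0) (cayleyTrans ψ) ?_ ?_, ?_⟩
  · intro a p q q' h h'
    simp only [cayleyTrans, ne_eq, ite_eq_right_iff, one_ne_zero, imp_false, not_not] at h h'
    exact h.2.trans h'.2.symm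
  · intro a p p' q h h'
    simp only [cayleyTrans, ne_eq, ite_eq_right_iff, one_ne_zero, imp_false, not_not] at h h'
    obtain ⟨h1, h2⟩ := Prod.mk.inj (h.2.symm.trans h'.2)
    exact Prod.ext h1 (mul_right_cancel h2)
  · ext w
    have hseries : (fun p : Finset (G × α) × G => if p.2 = 1 then (1 : ZMod 2) else 0) ⬝ᵥ
        (w.map (cayleyTrans ψ)).prod.mulVec (fun p => ∑ D, if p.1 ⊆ D then F D p.2 else 0) =
        F (edges ψ 1 w).toFinset (w.map ψ).prod := by
      rw [← sum_ge_sum_ge (fun D => F D (w.map ψ).prod)]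
      simp only [dotProduct, Fintype.sum_prod_type, ite_mul, one_mul, zero_mul,
        Finset.sum_ite_eq', Finset.mem_univ, if_true, cayleyTrans_prod_mulVec,
        Set.toFinset_subset]
    simp only [supp, Set.mem_ofPred_eq, hseries, F, Set.coe_toFinset, ne_eq, ite_eq_right_iff,
      one_ne_zero, imp_false, not_not]
    exact ⟨fun ⟨u, hu, h1, h2⟩ => hL u w h1 h2 hu, fun hw => ⟨w, hw, rfl, rfl⟩⟩

end CayleyAutomaton

lemma EComRecognizer.mem_RevL {α : Type} [Finite α] {L : Set (List α)}
    (R : EComRecognizer α L) : L ∈ RevL (ZMod 2) α := by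
  have := R.fintypeM
  let := R.monoidM
  let φ : α → R.M := fun a => R.φ (FreeMonoid.of a)
  have hR : ∀ w : List α, R.φ (FreeMonoid.ofList w) = (w.map φ).prod := by
    intro w
    induction w with
    | nil => exact map_one R.φ
    | cons a w ih => rw [FreeMonoid.ofList_cons, map_mul, ih, List.map_cons, List.prod_cons]
  obtain ⟨G, _, _, ψ, hψ⟩ := exists_group R.idemComm φ
  refine mem_RevL_of_edges ψ L fun u v he huv hu => ?_
  rw [R.recog, Set.mem_ofPred_eq, hR] at hu ⊢
  rwa [← prod_eq_of_edges_eq R.idemComm hψ 1 u v he huv]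

section ReversibleMatrices

variable {S : Type} {n : ℕ}

/-- The monoid of matrices with at most one nonzero entry in each row and column. -/
def reversibleMatrices (S : Type) [Semiring S] (n : ℕ) :
    Submonoid (Matrix (Fin n) (Fin n) S) where
  carrier := {E | rowOk E ∧ colOk E}
  one_mem' := by
    constructor
    · intro i j j' h h'
      rw [← not_imp_comm.1 Matrix.one_apply_ne h, ← not_imp_comm.1 Matrix.one_apply_ne h']
    · intro i i' j h h'
      rw [not_imp_comm.1 Matrix.one_apply_ne h, not_imp_comm.1 Matrix.one_apply_ne h']
  mul_mem' := by
    intro E F hE hF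
    have key : ∀ i j, (E * F) i j ≠ 0 → ∃ k, E i k ≠ 0 ∧ F k j ≠ 0 := by
      intro i j h
      obtain ⟨k, -, hk⟩ := Finset.exists_ne_zero_of_sum_ne_zero (Matrix.mul_apply (M := E) ▸ h)
      exact ⟨k, left_ne_zero_of_mul hk, right_ne_zero_of_mul hk⟩
    constructor
    · intro i j j' h h'
      obtain ⟨k, h1, h2⟩ := key _ _ h
      obtain ⟨k', h1', h2'⟩ := key _ _ h'
      obtain rfl := hE.1 _ _ _ h1 h1'
      exact hF.1 _ _ _ h2 h2'
    · intro i i' j h h'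
      obtain ⟨k, h1, h2⟩ := key _ _ h
      obtain ⟨k', h1', h2'⟩ := key _ _ h'
      obtain rfl := hF.2 _ _ _ h2 h2'
      exact hE.2 _ _ _ h1 h1'

lemma isDiag_of_idempotent [Semiring S] {E : Matrix (Fin n) (Fin n) S}
    (hE : E ∈ reversibleMatrices S n) (hi : E * E = E) : E.IsDiag := by
  intro i j hij
  by_contra h
  have h' := h
  rw [← hi, Matrix.mul_apply] at h'
  obtain ⟨k, -, hk⟩ := Finset.exists_ne_zero_of_sum_ne_zero h'
  obtain rfl := hE.1 _ _ _ h (left_ne_zero_of_mul hk)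
  exact hij (hE.2 _ _ _ h (right_ne_zero_of_mul hk))

lemma reversibleMatrices_idempotent_comm [CommSemiring S] {E F : reversibleMatrices S n}
    (hE : E * E = E) (hF : F * F = F) : E * F = F * E := by
  have hE' := (isDiag_of_idempotent E.2 (congrArg Subtype.val hE)).diagonal_diag
  have hF' := (isDiag_of_idempotent F.2 (congrArg Subtype.val hF)).diagonal_diag
  apply Subtype.ext
  rw [Submonoid.coe_mul, Submonoid.coe_mul, ← hE', ← hF', Matrix.diagonal_mul_diagonal,
    Matrix.diagonal_mul_diagonal]
  simp only [mul_comm]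

end ReversibleMatrices

lemma nonempty_EComRecognizer_of_mem_RevL {S α : Type} [CommSemiring S] [Finite S]
    {L : Set (List α)} (h : L ∈ RevL S α) : Nonempty (EComRecognizer α L) := by
  obtain ⟨_, ⟨A, hA, rfl⟩, rfl⟩ := h
  have : Finite (reversibleMatrices S A.n) :=
    Finite.of_injective (fun E => (E : Matrix (Fin A.n) (Fin A.n) S)) Subtype.val_injective
  have := Fintype.ofFinite (reversibleMatrices S A.n)
  let φ : FreeMonoid α →* reversibleMatrices S A.n := FreeMonoid.lift fun a => ⟨A.trans a, hA a⟩
  have hφ : ∀ w : List α, (φ (FreeMonoid.ofList w) : Matrix _ _ S) = A.matWord w := by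
    intro w
    simp [φ, FreeMonoid.lift_apply, WA.matWord, Function.comp_def]
  refine ⟨⟨_, fun _ _ => reversibleMatrices_idempotent_comm, φ,
    {E | A.init ⬝ᵥ E.1.mulVec A.final ≠ 0}, ?_⟩⟩
  ext w
  simp [supp, WA.series, hφ]

end RevWA

open RevWA in
theorem stmt11 (α : Type) [Fintype α] [Nonempty α] (L : Set (List α)) :
    L ∈ RevL (ZMod 2) α ↔ Nonempty (EComRecognizer α L) :=
  ⟨nonempty_EComRecognizer_of_mem_RevL, fun ⟨R⟩ => R.mem_RevL⟩
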